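/- arXiv:1208.5855 — 2 statements merged into one kernel-verified Lean document; each statement's English description precedes it below -/
import Mathlib

section
/- Let F∞, Sπ∞ ⊆ S be two subsets, and for p ∈ S define W*Fπ(p) ∈ ℝ≥0∞ as the infimum over p' ∈ F∞ of W*(p, {p'}) + W*(p', Sπ∞) (the minimum weight of a finite run from p to Sπ∞ passing through a state of F∞). Then for every state p ∉ F∞ with W*Fπ(p) < ∞, there exists a state p'' with δ p p'' such that W*Fπ(p'') < W*Fπ(p). (This is the second half of Lemma 2 of the paper: every state outside F∞ has a successor strictly decreasing the combined distance through F∞ to Sπ∞; equivalently, every such state has an outgoing transition whose shortening indicator I_{Pφ} equals 1.) -/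
open scoped ENNReal

/-- A finite path of length `n` w.r.t. transition relation `δ`:
`δ (r i) (r (i+1))` holds for all `i < n`. -/
def IsPath {S : Type*} (δ : S → S → Prop) (r : ℕ → S) (n : ℕ) : Prop :=
  ∀ i < n, δ (r i) (r (i + 1))

/-- Weight of the finite path `r 0, r 1, …, r n`. -/
noncomputable def pathWeight {S : Type*} (W : S → S → ℝ) (r : ℕ → S) (n : ℕ) : ℝ :=
  ∑ i ∈ Finset.range n, W (r i) (r (i + 1))

/-- Minimum weight `W*(p, B)` of a finite path from `p` ending in a state of `B`,
as an element of `ℝ≥0∞` (`∞` if no such path exists). -/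
noncomputable def Wstar {S : Type*} (δ : S → S → Prop) (W : S → S → ℝ)
    (p : S) (B : Set S) : ℝ≥0∞ :=
  sInf {w : ℝ≥0∞ | ∃ (n : ℕ) (r : ℕ → S), r 0 = p ∧ IsPath δ r n ∧ r n ∈ B ∧
    w = ENNReal.ofReal (pathWeight W r n)}

/-- The combined distance `W*Fπ(p)`: the minimum weight of a finite run from `p`
to `Sπ∞` passing through a state of `F∞`. -/
noncomputable def WstarFpi {S : Type*} (δ : S → S → Prop) (W : S → S → ℝ)
    (Finf Sπinf : Set S) (p : S) : ℝ≥0∞ :=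
  ⨅ p' ∈ Finf, Wstar δ W p {p'} + Wstar δ W p' Sπinf

lemma pathWeight_succ {S : Type*} (W : S → S → ℝ) (r : ℕ → S) (n : ℕ) :
    pathWeight W r (n + 1) = W (r 0) (r 1) + pathWeight W (fun i => r (i + 1)) n := by
  simp only [pathWeight, Finset.sum_range_succ', zero_add, add_comm]

lemma IsPath.tail {S : Type*} {δ : S → S → Prop} {r : ℕ → S} {n : ℕ}
    (h : IsPath δ r (n + 1)) : IsPath δ (fun i => r (i + 1)) n :=
  fun i hi => h (i + 1) (by lia)

lemma IsPath.pathWeight_nonneg {S : Type*} {δ : S → S → Prop} {W : S → S → ℝ}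
    (hW : ∀ p p', δ p p' → 0 ≤ W p p') {r : ℕ → S} {n : ℕ} (h : IsPath δ r n) :
    0 ≤ pathWeight W r n :=
  Finset.sum_nonneg fun i hi => hW _ _ (h i (Finset.mem_range.1 hi))

lemma IsPath.Wstar_le {S : Type*} {δ : S → S → Prop} {W : S → S → ℝ} {r : ℕ → S} {n : ℕ}
    (h : IsPath δ r n) {B : Set S} (hB : r n ∈ B) :
    Wstar δ W (r 0) B ≤ ENNReal.ofReal (pathWeight W r n) :=
  sInf_le ⟨n, r, rfl, h, hB, rfl⟩

/-- Outside the target, the minimum weight is at least the cost of some first transition plus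
the minimum weight from there on. -/
lemma iInf_succ_add_Wstar_le {S : Type*} {δ : S → S → Prop} {W : S → S → ℝ}
    (hW : ∀ p p', δ p p' → 0 ≤ W p p') {p : S} {B : Set S} (hp : p ∉ B) :
    ⨅ q, ⨅ _ : δ p q, ENNReal.ofReal (W p q) + Wstar δ W q B ≤ Wstar δ W p B := by
  refine le_sInf ?_
  rintro _ ⟨n, r, rfl, hr, hB, rfl⟩
  cases n with
  | zero => exact absurd hB hp
  | succ n =>
    have h01 : δ (r 0) (r 1) := hr 0 n.succ_pos
    rw [pathWeight_succ, ENNReal.ofReal_add (hW _ _ h01) (hr.tail.pathWeight_nonneg hW)]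
    exact (iInf₂_le (r 1) h01).trans (by gcongr; exact hr.tail.Wstar_le hB)

/-- **second half of Lemma 2.** For `p ∉ F∞` with `W*Fπ(p) < ∞`, there is a
successor `p''` of `p` with `W*Fπ(p'') < W*Fπ(p)`. -/
theorem exists_succ_WstarFpi_lt
    (S : Type*) [Fintype S] (δ : S → S → Prop) (W : S → S → ℝ)
    (hW : ∀ p p', δ p p' → 0 < W p p') (Finf Sπinf : Set S) (p : S)
    (hp : p ∉ Finf) (hfin : WstarFpi δ W Finf Sπinf p < ⊤) :
    ∃ p'' : S, δ p p'' ∧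
      WstarFpi δ W Finf Sπinf p'' < WstarFpi δ W Finf Sπinf p := by
  classical
  by_contra! hle
  set V := WstarFpi δ W Finf Sπinf p
  let ε : ℝ≥0∞ := ({q | δ p q} : Finset S).inf fun q => ENNReal.ofReal (W p q)
  have hε : 0 < ε := by
    refine (Finset.lt_inf_iff ENNReal.zero_lt_top).2 fun q hq => ?_
    exact ENNReal.ofReal_pos.2 (hW p q (Finset.mem_filter.1 hq).2)
  have hVε : V + ε ≤ V := by
    refine le_iInf₂ fun f hf => ?_
    have hpf : p ∉ ({f} : Set S) := by
      rintro rfl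
      exact hp hf
    refine le_trans ?_ (add_le_add_left
      (iInf_succ_add_Wstar_le (fun a b h => (hW a b h).le) hpf) _)
    simp only [ENNReal.iInf_add]
    refine le_iInf₂ fun q hq => ?_
    rw [add_assoc, add_comm V]
    exact add_le_add (Finset.inf_le (by simpa using hq))
      ((hle q hq).trans (iInf₂_le f hf))
  exact (ENNReal.lt_add_right hfin.ne hε.ne').not_ge hVε
end

section
/- Let (F∞, Sπ∞) be a greatest admissible pair for (F, Sπ). If a run ϱ : ℕ → S visits F infinitely often and visits Sπ infinitely often, then for every index k one has W*(ϱ k, Sπ∞) < ∞ and W*(ϱ k, F∞) < ∞. (Hence states with W*_{Pπ}(p) = ∞ or infinite distance to F∞ cannot occur on any accepting run and may be removed from the product automaton.) -/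
open scoped ENNReal

/-- A pair `(A, B)` is admissible for `(F, Sπ)`:
`A ⊆ F`, `B ⊆ Sπ`, every state of `A` has a finite path with at least one transition
ending in a state of `B`, and every state of `B` has a finite path with at least one
transition ending in a state of `A`. -/
def Admissible {S : Type*} (δ : S → S → Prop) (F Sπ A B : Set S) : Prop :=
  A ⊆ F ∧ B ⊆ Sπ ∧
  (∀ p ∈ A, ∃ (n : ℕ) (r : ℕ → S), 1 ≤ n ∧ r 0 = p ∧ IsPath δ r n ∧ r n ∈ B) ∧
  (∀ p ∈ B, ∃ (n : ℕ) (r : ℕ → S), 1 ≤ n ∧ r 0 = p ∧ IsPath δ r n ∧ r n ∈ A)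

/-- A run that visits `B` infinitely often has, from each of its positions, a nonempty finite
path to a state of `B` that it visits. -/
theorem exists_isPath_of_run {S : Type*} {δ : S → S → Prop} {ϱ : ℕ → S}
    (hrun : ∀ k, δ (ϱ k) (ϱ (k + 1))) {B : Set S} (hB : {k | ϱ k ∈ B}.Infinite) (k : ℕ) :
    ∃ (n : ℕ) (r : ℕ → S), 1 ≤ n ∧ r 0 = ϱ k ∧ IsPath δ r n ∧ r n ∈ B ∩ Set.range ϱ := by
  obtain ⟨m, hm, hkm⟩ := hB.exists_gt k
  refine ⟨m - k, fun i => ϱ (k + i), by omega, rfl, fun i _ => hrun (k + i), ?_⟩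
  simpa [Nat.add_sub_cancel' hkm.le] using hm

/-- The minimum weight to `B` is finite as soon as some finite path ends in `B`. -/
theorem Wstar_lt_top_of_isPath {S : Type*} {δ : S → S → Prop} (W : S → S → ℝ) {p : S} {B : Set S}
    {n : ℕ} {r : ℕ → S} (h0 : r 0 = p) (hr : IsPath δ r n) (hn : r n ∈ B) :
    Wstar δ W p B < ⊤ :=
  sInf_lt_iff.2 ⟨_, ⟨n, r, h0, hr, hn, rfl⟩, ENNReal.ofReal_lt_top⟩

/-- Let `(F∞, Sπ∞)` be a greatest admissible pair for `(F, Sπ)`. If a run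
visits `F` infinitely often and `Sπ` infinitely often, then every state on the run has
finite minimum path weight both to `Sπ∞` and to `F∞`. -/
theorem Wstar_lt_top_on_accepting_run
    (S : Type*) [Fintype S] (δ : S → S → Prop) (W : S → S → ℝ)
    (hW : ∀ p p', δ p p' → 0 < W p p') (F Sπ : Set S) (Finf Sπinf : Set S)
    (hadm : Admissible δ F Sπ Finf Sπinf)
    (hgreat : ∀ A B : Set S, Admissible δ F Sπ A B → A ⊆ Finf ∧ B ⊆ Sπinf)
    (ϱ : ℕ → S) (hrun : ∀ k, δ (ϱ k) (ϱ (k + 1)))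
    (hF : {k | ϱ k ∈ F}.Infinite) (hSπ : {k | ϱ k ∈ Sπ}.Infinite) :
    ∀ k, Wstar δ W (ϱ k) Sπinf < ⊤ ∧ Wstar δ W (ϱ k) Finf < ⊤ := by
  have hsub : F ∩ Set.range ϱ ⊆ Finf ∧ Sπ ∩ Set.range ϱ ⊆ Sπinf := by
    refine hgreat _ _ ⟨Set.inter_subset_left, Set.inter_subset_left, ?_, ?_⟩
    · rintro _ ⟨-, k, rfl⟩
      exact exists_isPath_of_run hrun hSπ k
    · rintro _ ⟨-, k, rfl⟩
      exact exists_isPath_of_run hrun hF k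
  intro k
  obtain ⟨n, r, -, h0, hr, hn⟩ := exists_isPath_of_run hrun hSπ k
  obtain ⟨n', r', -, h0', hr', hn'⟩ := exists_isPath_of_run hrun hF k
  exact ⟨Wstar_lt_top_of_isPath W h0 hr (hsub.2 hn), Wstar_lt_top_of_isPath W h0' hr' (hsub.1 hn')⟩
end
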